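/- Let n ≥ 2, let a = (a_0, a_1, ..., a_{n-1}) ∈ ℝ^n be regarded as an n×1 matrix, and let L be the affine hyperplane of ℝ^n parametrized by x = (x_1,...,x_{n-1}) ↦ (x_1,...,x_{n-1}, a_0 + a_1 x_1 + ... + a_{n-1} x_{n-1}). Set k = #{1 ≤ i ≤ n-1 : a_i ≠ 0}. Then L is strongly extremal if and only if a ∉ W_{k+1}^+(n,1), that is, if and only if for every v > k+1 there are only finitely many q ∈ ℤ for which ‖aq + p‖ ≤ |q|^{-v} for some p ∈ ℤ^n. -/

import Mathlib

open MeasureTheory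

/-- `y` is very well multiplicatively approximable: for some `v > n` there are infinitely
many `q ∈ ℤ^n` with `|y·q + p| ≤ Π_+(q)^{-v/n}` for some `p ∈ ℤ`, where
`Π_+(q) = ∏ᵢ max(|qᵢ|,1)`. -/
def IsVWMA {n : ℕ} (y : Fin n → ℝ) : Prop :=
  ∃ v : ℝ, (n : ℝ) < v ∧
    {q : Fin n → ℤ | ∃ p : ℤ,
      |(∑ i, y i * (q i : ℝ)) + (p : ℝ)| ≤
        (∏ i, max |(q i : ℝ)| 1) ^ (-(v / n))}.Infinite

/-- `f` is strongly extremal on `U`: `f x` is not VWMA for a.e. `x ∈ U`. -/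
def IsStronglyExtremal {α : Type*} [MeasureSpace α] {n : ℕ} (U : Set α)
    (f : α → Fin n → ℝ) : Prop :=
  volume {x ∈ U | IsVWMA (f x)} = 0

theorem summable_pi_prod_of_nonneg {ι : Type*} {f : ι → ℝ} (hf : Summable f) (h0 : ∀ i, 0 ≤ f i)
    (n : ℕ) : Summable fun q : Fin n → ι => ∏ i, f (q i) := by
  induction n with
  | zero => exact Summable.of_finite
  | succ n ih =>
    have h := hf.mul_of_nonneg ih h0 fun q => Finset.prod_nonneg fun i _ => h0 _
    rw [← (Fin.consEquiv fun _ => ι).summable_iff]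
    refine h.congr fun q => ?_
    simp [Fin.consEquiv, Fin.prod_univ_succ]

theorem one_le_prod_max_abs {n : ℕ} (q : Fin n → ℤ) : 1 ≤ ∏ i, max |(q i : ℝ)| 1 := by
  simpa using Finset.prod_le_prod (s := Finset.univ) (f := fun _ : Fin n => (1 : ℝ))
    (fun i _ => zero_le_one) fun i _ => le_max_right |(q i : ℝ)| 1

theorem summable_prod_max_abs_rpow {w : ℝ} (hw : 1 < w) (n : ℕ) :
    Summable fun q : Fin n → ℤ => (∏ i, max |(q i : ℝ)| 1) ^ (-w) := by
  have h1 : Summable fun q : ℤ => (max |(q : ℝ)| 1) ^ (-w) := by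
    refine Summable.of_nonneg_of_le (fun q => by positivity) (fun q => ?_)
      ((Real.summable_abs_int_rpow hw).add
        (summable_of_hasFiniteSupport (f := fun q : ℤ => if q = 0 then (1 : ℝ) else 0)
          ((Set.finite_singleton 0).subset fun q hq => by simpa using hq)))
    rcases eq_or_ne q 0 with rfl | hq
    · simp [Real.zero_rpow (by linarith : -w ≠ 0)]
    · have : (1 : ℝ) ≤ |(q : ℝ)| := by exact_mod_cast Int.one_le_abs hq
      simp [max_eq_left this, hq]
  refine (summable_pi_prod_of_nonneg h1 (fun q => by positivity) n).congr fun q => ?_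
  exact Real.finsetProd_rpow _ _ (fun i _ => by positivity) _

theorem summable_nat_rpow_div_norm_nsmul {G : Type*} [SeminormedAddCommGroup G] {A : G}
    {c τ α : ℝ} (hc : 0 < c) (hτ : 1 ≤ τ) (hα : τ < α) (h1 : ∀ q : ℕ, ‖q • A‖ ≤ 1)
    (hA : ∀ q : ℕ, q ≠ 0 → c * (q : ℝ) ^ (-τ) ≤ ‖q • A‖) :
    Summable fun q : ℕ => (q : ℝ) ^ (-α) / ‖q • A‖ := by
  have hτ0 : 0 < τ := by linarith
  set g : ℕ → ℝ := fun s => (c / 2 * 2 ^ s) ^ τ⁻¹ with hg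
  have hg0 : ∀ s, 0 < g s := fun s => by positivity
  have hpos : ∀ q : ℕ, q ≠ 0 → 0 < ‖q • A‖ := fun q hq => by
    have : (0 : ℝ) < q := by exact_mod_cast Nat.pos_of_ne_zero hq
    exact lt_of_lt_of_le (by positivity) (hA q hq)
  have gap : ∀ (s q : ℕ), q ≠ 0 → ‖q • A‖ ≤ 2 * (1 / 2) ^ s → g s ≤ q := by
    intro s q hq h
    have hq0 : (0 : ℝ) < q := by exact_mod_cast Nat.pos_of_ne_zero hq
    rw [hg, Real.rpow_inv_le_iff_of_pos (by positivity) hq0.le hτ0]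
    have h2 := (hA q hq).trans h
    have hqτ : 0 < (q : ℝ) ^ τ := by positivity
    rw [Real.rpow_neg hq0.le, one_div, inv_pow, ← div_eq_mul_inv, ← div_eq_mul_inv,
      div_le_div_iff₀ hqτ (by positivity)] at h2
    linarith
  have hshell : ∀ q : ℕ, ∃ s : ℕ, q ≠ 0 →
      (1 / 2 : ℝ) ^ (s + 1) < ‖q • A‖ ∧ ‖q • A‖ ≤ (1 / 2) ^ s := by
    intro q
    by_cases hq : q = 0
    · exact ⟨0, fun h => absurd hq h⟩
    · obtain ⟨s, hs⟩ := exists_nat_pow_near_of_lt_one (hpos q hq) (h1 q)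
        (by norm_num : (0 : ℝ) < 1 / 2) (by norm_num)
      exact ⟨s, fun _ => hs⟩
  choose σ hσ using hshell
  have hF : Summable fun x : ℕ × ℕ =>
      (2 * 2 ^ x.1 * (g x.1) ^ (-α)) * (x.2 : ℝ) ^ (-α) := by
    refine Summable.mul_of_nonneg (f := fun s : ℕ => 2 * 2 ^ s * (g s) ^ (-α))
      (g := fun j : ℕ => (j : ℝ) ^ (-α)) ?_ (Real.summable_nat_rpow.2 (by linarith))
      (fun s => by have := hg0 s; positivity) (fun j => by positivity)
    have hr : (2 : ℝ) ^ (1 - α / τ) < 1 :=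
      Real.rpow_lt_one_of_one_lt_of_neg (by norm_num) (by
        have : 1 < α / τ := (one_lt_div hτ0).2 hα
        linarith)
    refine ((summable_geometric_of_lt_one (by positivity) hr).mul_left
      (2 * (c / 2) ^ (-(α / τ)))).congr fun s => ?_
    rw [hg]
    simp only
    rw [← Real.rpow_mul (by positivity), show τ⁻¹ * -α = -(α / τ) by field_simp,
      Real.mul_rpow (by positivity) (by positivity), Real.rpow_sub (by norm_num), Real.rpow_one,
      div_pow, Real.rpow_neg (x := (2 : ℝ) ^ s) (by positivity), ← Real.rpow_natCast 2 s,
      ← Real.rpow_mul (by norm_num), mul_comm (s : ℝ), Real.rpow_mul (by norm_num),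
      Real.rpow_natCast, Real.rpow_natCast]
    ring
  rw [← summable_nat_add_iff 1]
  set φ : ℕ → ℕ × ℕ := fun q => (σ (q + 1), ⌊((q + 1 : ℕ) : ℝ) / g (σ (q + 1))⌋₊) with hφ
  have hlt : ∀ q q' : ℕ, q < q' → φ q ≠ φ q' := by
    intro q q' hqq h
    rw [hφ, Prod.mk.injEq] at h
    obtain ⟨hs, hj⟩ := h
    have hq := (hσ (q + 1) (by omega)).2
    have hq' := (hσ (q' + 1) (by omega)).2
    rw [← hs] at hq' hj
    set s := σ (q + 1)
    have hgs := hg0 s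
    have hd : g s ≤ ((q' - q : ℕ) : ℝ) := by
      refine gap s _ (by omega) ?_
      have : (q' - q) • A = (q' + 1) • A - (q + 1) • A := by
        rw [eq_sub_iff_add_eq, ← add_nsmul]
        congr 1
        omega
      rw [this]
      refine (norm_sub_le _ _).trans ?_
      linarith
    have e1 := Nat.floor_le (div_nonneg (Nat.cast_nonneg (q + 1)) hgs.le : (0 : ℝ) ≤ _)
    have e2 := Nat.lt_floor_add_one (((q' + 1 : ℕ) : ℝ) / g s)
    rw [← hj] at e2
    have e3 : ((q' + 1 : ℕ) : ℝ) / g s < ((q + 1 : ℕ) : ℝ) / g s + 1 := by linarith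
    rw [div_add_one hgs.ne', div_lt_div_iff_of_pos_right hgs] at e3
    push_cast [Nat.cast_sub hqq.le] at hd e3
    linarith
  have hinj : Function.Injective φ := by
    intro q q' h
    rcases lt_trichotomy q q' with hl | rfl | hl
    · exact absurd h (hlt _ _ hl)
    · rfl
    · exact absurd h.symm (hlt _ _ hl)
  refine Summable.of_nonneg_of_le (fun q => by positivity) (fun q => ?_) (hF.comp_injective hinj)
  obtain ⟨hl, hu⟩ := hσ (q + 1) (by omega)
  simp only [Function.comp, hφ]
  set s := σ (q + 1)
  have hgs := hg0 s
  have hgq : g s ≤ ((q + 1 : ℕ) : ℝ) :=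
    gap s _ (by omega) (hu.trans (by have : (0 : ℝ) < (1 / 2) ^ s := by positivity
                                     linarith))
  have hj1 : 1 ≤ ⌊((q + 1 : ℕ) : ℝ) / g s⌋₊ := by
    rw [Nat.one_le_floor_iff, le_div_iff₀ hgs]
    linarith
  have hjq := Nat.floor_le (div_nonneg (Nat.cast_nonneg (q + 1)) hgs.le : (0 : ℝ) ≤ _)
  rw [le_div_iff₀ hgs] at hjq
  set j := ⌊((q + 1 : ℕ) : ℝ) / g s⌋₊
  have hj0 : (0 : ℝ) < j := by exact_mod_cast hj1
  have b1 : ((q + 1 : ℕ) : ℝ) ^ (-α) ≤ g s ^ (-α) * (j : ℝ) ^ (-α) := by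
    rw [← Real.mul_rpow hgs.le hj0.le, mul_comm (g s)]
    exact Real.rpow_le_rpow_of_nonpos (by positivity) hjq (by linarith)
  have b2 : ‖(q + 1) • A‖⁻¹ ≤ 2 * 2 ^ s := by
    rw [inv_le_comm₀ (hpos _ (by omega)) (by positivity)]
    refine le_trans (le_of_eq ?_) hl.le
    rw [one_div, inv_pow, pow_succ, mul_comm]
  rw [div_eq_mul_inv]
  calc _ ≤ (g s ^ (-α) * (j : ℝ) ^ (-α)) * (2 * 2 ^ s) := by gcongr
    _ = _ := by ring

theorem summable_int_rpow_div_norm_zsmul {G : Type*} [SeminormedAddCommGroup G] {A : G}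
    {c τ α : ℝ} (hc : 0 < c) (hτ : 1 ≤ τ) (hα : τ < α) (h1 : ∀ q : ℤ, ‖q • A‖ ≤ 1)
    (hA : ∀ q : ℤ, q ≠ 0 → c * |(q : ℝ)| ^ (-τ) ≤ ‖q • A‖) :
    Summable fun q : ℤ => |(q : ℝ)| ^ (-α) / ‖q • A‖ := by
  have h := summable_nat_rpow_div_norm_nsmul (A := A) hc hτ hα
    (fun q => by simpa using h1 q) (fun q hq => by simpa using hA q (by exact_mod_cast hq))
  rw [summable_int_iff_summable_nat_and_neg]
  exact ⟨by simpa using h, by simpa using h⟩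

theorem exists_pos_forall_mul_rpow_le_norm_zsmul {G : Type*} [NormedAddCommGroup G] {A : G}
    {τ : ℝ} (hfin : {q : ℤ | ‖q • A‖ ≤ |(q : ℝ)| ^ (-τ)}.Finite) :
    ∃ c : ℝ, 0 < c ∧ ∀ q : ℤ, q ≠ 0 → c * |(q : ℝ)| ^ (-τ) ≤ ‖q • A‖ := by
  have hpos : ∀ q : ℤ, q ≠ 0 → 0 < ‖q • A‖ := by
    intro q hq
    rw [norm_pos_iff]
    intro h0
    refine Set.infinite_of_injective_forall_mem (f := fun j : ℤ => j * q)
      (mul_left_injective₀ hq) (fun j => ?_) hfin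
    simp only [Set.mem_ofPred_eq, mul_smul, h0, smul_zero, norm_zero]
    positivity
  obtain ⟨K, hK⟩ := (hfin.image fun q : ℤ => |(q : ℝ)| ^ (-τ) / ‖q • A‖).bddAbove
  refine ⟨(max K 1)⁻¹, by positivity, fun q hq => ?_⟩
  rw [inv_mul_le_iff₀ (by positivity), ← div_le_iff₀ (hpos q hq)]
  by_cases hm : ‖q • A‖ ≤ |(q : ℝ)| ^ (-τ)
  · exact (hK (Set.mem_image_of_mem _ hm)).trans (le_max_left _ _)
  · exact ((div_le_one (hpos q hq)).2 (not_le.1 hm).le).trans (le_max_right _ _)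

theorem volume_le_of_volume_fiber_le {m : ℕ} (i : Fin m) {S : Set (Fin m → ℝ)}
    (hS : MeasurableSet S) {M k : ℝ} (hM : 1 ≤ M) (hk : 0 ≤ k) (hbox : ∀ x ∈ S, ∀ j, |x j| ≤ M)
    (h : ∀ x : Fin m → ℝ, volume {t : ℝ | Function.update x i t ∈ S} ≤ ENNReal.ofReal k) :
    volume S ≤ ENNReal.ofReal (k * (2 * M) ^ m) := by
  cases m with
  | zero => exact i.elim0
  | succ m =>
    set e := MeasurableEquiv.piFinSuccAbove (fun _ : Fin (m + 1) => ℝ) i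
    have hvp := volume_preserving_piFinSuccAbove (fun _ : Fin (m + 1) => ℝ) i
    rw [← hvp.symm.measure_preimage_equiv, Measure.volume_eq_prod,
      Measure.prod_apply_symm (e.symm.measurable hS)]
    have hle : ∀ y : Fin m → ℝ, volume ((fun t : ℝ => (t, y)) ⁻¹' (e.symm ⁻¹' S)) ≤
        (Set.Icc (fun _ => -M) (fun _ => M)).indicator (fun _ => ENNReal.ofReal k) y := by
      intro y
      by_cases hy : y ∈ Set.Icc (fun _ : Fin m => -M) (fun _ => M)
      · rw [Set.indicator_of_mem hy]
        refine le_trans (le_of_eq ?_) (h (i.insertNth (0 : ℝ) y))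
        simp only [Fin.update_insertNth]
        rfl
      · rw [Set.indicator_of_notMem hy, nonpos_iff_eq_zero]
        convert measure_empty (μ := volume)
        refine Set.eq_empty_of_forall_notMem fun t ht => hy ?_
        have hx : ∀ j, |y j| ≤ M := fun j => by
          have : |(i.insertNth t y : Fin (m + 1) → ℝ) (i.succAbove j)| ≤ M := hbox _ ht _
          simpa using this
        exact ⟨fun j => (abs_le.1 (hx j)).1, fun j => (abs_le.1 (hx j)).2⟩
    refine (lintegral_mono hle).trans ?_
    rw [lintegral_indicator_const measurableSet_Icc, Real.volume_Icc_pi, Finset.prod_const,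
      Finset.card_univ, Fintype.card_fin, ← ENNReal.ofReal_pow (by linarith),
      ← ENNReal.ofReal_mul hk]
    refine ENNReal.ofReal_le_ofReal (mul_le_mul_of_nonneg_left ?_ hk)
    rw [show M - -M = 2 * M by ring]
    exact pow_le_pow_right₀ (by linarith) (Nat.le_succ m)

theorem exists_sum_mul_update_eq {m : ℕ} (c x : Fin m → ℝ) (i : Fin m) :
    ∃ b : ℝ, ∀ t : ℝ, ∑ j, c j * Function.update x i t j = c i * t + b := by
  refine ⟨∑ j ∈ Finset.univ.erase i, c j * x j, fun t => ?_⟩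
  rw [← Finset.add_sum_erase _ _ (Finset.mem_univ i), Function.update_self]
  congr 1
  exact Finset.sum_congr rfl fun j hj => by rw [Function.update_of_ne (Finset.ne_of_mem_erase hj)]

theorem volume_abs_mul_add_le {c : ℝ} (hc : c ≠ 0) (b ε : ℝ) :
    volume {t : ℝ | |c * t + b| ≤ ε} ≤ ENNReal.ofReal (2 * (ε / |c|)) := by
  rw [← Real.volume_closedBall (-b / c) (ε / |c|)]
  refine measure_mono fun t ht => ?_
  rw [Metric.mem_closedBall, Real.dist_eq, le_div_iff₀ (abs_pos.2 hc), ← abs_mul,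
    show (t - -b / c) * c = c * t + b by field_simp; ring]
  exact ht

theorem abs_sum_mul_le {m : ℕ} {c x : Fin m → ℝ} {M r : ℝ} (hr : 0 ≤ r)
    (hx : ∀ j, |x j| ≤ M) (hc : ∀ j, |c j| ≤ r) : |∑ j, c j * x j| ≤ m * (r * M) := by
  refine (Finset.abs_sum_le_sum_abs _ _).trans ?_
  have := Finset.sum_le_card_nsmul Finset.univ (fun j => |c j * x j|) (r * M) fun j _ => by
    rw [abs_mul]
    exact mul_le_mul (hc j) (hx j) (abs_nonneg _) hr
  simpa using this

theorem card_Icc_ceil_floor_le (b : ℝ) {R : ℝ} (hR : 0 ≤ R) :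
    ((Finset.Icc ⌈-b - R⌉ ⌊-b + R⌋).card : ℝ) ≤ 2 * R + 1 := by
  rw [Int.card_Icc]
  have h1 := Int.floor_le (-b + R)
  have h2 := Int.le_ceil (-b - R)
  have : (((⌊-b + R⌋ + 1 - ⌈-b - R⌉).toNat : ℤ) : ℝ) ≤ 2 * R + 1 := by
    rw [Int.toNat_eq_max]
    push_cast
    exact max_le (by linarith) (by linarith)
  exact_mod_cast this

/-- If the condition `|u t + p| ≤ ε` on an integer `p` forces `|b + p| ≤ R`, then at most `2R + 1`
integers are involved in the union over `p`. -/
theorem volume_exists_int_le {α : Type*} [MeasureSpace α] {B : Set α} {u : α → ℝ} {b R ε k : ℝ}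
    (hR : 0 ≤ R) (hu : ∀ t ∈ B, |u t - b| + ε ≤ R)
    (hk : ∀ p : ℤ, volume {t | t ∈ B ∧ |u t + p| ≤ ε} ≤ ENNReal.ofReal k) :
    volume {t | t ∈ B ∧ ∃ p : ℤ, |u t + p| ≤ ε} ≤ ENNReal.ofReal ((2 * R + 1) * k) := by
  set I := Finset.Icc ⌈-b - R⌉ ⌊-b + R⌋ with hI
  have hsub : {t | t ∈ B ∧ ∃ p : ℤ, |u t + p| ≤ ε} ⊆
      ⋃ p ∈ I, {t | t ∈ B ∧ |u t + p| ≤ ε} := by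
    rintro t ⟨ht, p, hp⟩
    have h1 := abs_le.1 hp
    have h2 := hu t ht
    have h3 := neg_abs_le (u t - b)
    have h4 := le_abs_self (u t - b)
    refine Set.mem_biUnion (x := p) ?_ ⟨ht, hp⟩
    rw [hI, Finset.mem_coe, Finset.mem_Icc, Int.ceil_le, Int.le_floor]
    constructor <;> linarith
  calc _ ≤ ∑ p ∈ I, volume {t | t ∈ B ∧ |u t + p| ≤ ε} :=
        (measure_mono hsub).trans (measure_biUnion_finset_le _ _)
    _ ≤ ∑ p ∈ I, ENNReal.ofReal k := Finset.sum_le_sum fun p _ => hk p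
    _ = ENNReal.ofReal (I.card * k) := by
        rw [Finset.sum_const, nsmul_eq_mul, ENNReal.ofReal_mul (by positivity),
          ENNReal.ofReal_natCast]
    _ ≤ ENNReal.ofReal ((2 * R + 1) * k) := by
        rcases le_total 0 k with h0 | h0
        · exact ENNReal.ofReal_le_ofReal
            (mul_le_mul_of_nonneg_right (card_Icc_ceil_floor_le b hR) h0)
        · rw [ENNReal.ofReal_of_nonpos (mul_nonpos_of_nonneg_of_nonpos (by positivity) h0)]
          exact zero_le

theorem volume_box_exists_int_le_of_half_le {m : ℕ} {c : Fin m → ℝ} {i : Fin m}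
    (hc : 1 / 2 ≤ |c i|) (b : ℝ) {M ε : ℝ} (hM : 1 ≤ M) (h0 : 0 ≤ ε) (h1 : ε ≤ 1) :
    volume {x : Fin m → ℝ | (∀ j, |x j| ≤ M) ∧ ∃ p : ℤ, |(∑ j, c j * x j) + b + p| ≤ ε} ≤
      ENNReal.ofReal ((4 * M + 12) * ε * (2 * M) ^ m) := by
  have hci : 0 < |c i| := by linarith
  refine volume_le_of_volume_fiber_le i ?_ hM (by positivity) (fun x hx => hx.1) fun x => ?_
  · have : {x : Fin m → ℝ | (∀ j, |x j| ≤ M) ∧ ∃ p : ℤ, |(∑ j, c j * x j) + b + p| ≤ ε} =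
        (⋂ j, {x | |x j| ≤ M}) ∩ ⋃ p : ℤ, {x | |(∑ j, c j * x j) + b + p| ≤ ε} := by
      ext x
      simp
    rw [this]
    refine (MeasurableSet.iInter fun j => ?_).inter (MeasurableSet.iUnion fun p => ?_)
    · exact (isClosed_le (by fun_prop) continuous_const).measurableSet
    · exact (isClosed_le (by fun_prop) continuous_const).measurableSet
  obtain ⟨b', hb'⟩ := exists_sum_mul_update_eq c x i
  have hsub : {t : ℝ | Function.update x i t ∈ {x : Fin m → ℝ | (∀ j, |x j| ≤ M) ∧
      ∃ p : ℤ, |(∑ j, c j * x j) + b + p| ≤ ε}} ⊆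
      {t | t ∈ {t : ℝ | |t| ≤ M} ∧ ∃ p : ℤ, |(c i * t + (b' + b)) + p| ≤ ε} := by
    rintro t ⟨ht, p, hp⟩
    refine ⟨by simpa using ht i, p, ?_⟩
    rw [hb'] at hp
    rwa [← add_assoc]
  refine (measure_mono hsub).trans ((volume_exists_int_le (b := b' + b) (R := M * |c i| + 1)
    (k := 2 * (ε / |c i|)) (by positivity) (fun t ht => ?_) fun p => ?_).trans ?_)
  · rw [add_sub_cancel_right, abs_mul]
    have : |c i| * |t| ≤ |c i| * M := mul_le_mul_of_nonneg_left ht hci.le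
    linarith
  · refine (measure_mono fun t ht => ?_).trans
      (volume_abs_mul_add_le (abs_pos.1 hci) (b' + b + p) ε)
    rw [Set.mem_ofPred_eq, ← add_assoc]
    exact ht.2
  · refine ENNReal.ofReal_le_ofReal ?_
    have : ε / |c i| ≤ 2 * ε := by
      rw [div_le_iff₀ hci]
      nlinarith
    have e : (2 * (M * |c i| + 1) + 1) * (2 * (ε / |c i|)) = 4 * M * ε + 6 * (ε / |c i|) := by
      field_simp
      ring
    rw [e]
    linarith

theorem volume_slab_le {m : ℕ} {c : Fin m → ℝ} {i : Fin m} (hc : c i ≠ 0) (b : ℝ) {M ε : ℝ}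
    (hM : 1 ≤ M) (h0 : 0 ≤ ε) :
    volume {x : Fin m → ℝ | (∀ j, |x j| ≤ M) ∧ |(∑ j, c j * x j) + b| ≤ ε} ≤
      ENNReal.ofReal (2 * (ε / |c i|) * (2 * M) ^ m) := by
  refine volume_le_of_volume_fiber_le i ?_ hM (by positivity) (fun x hx => hx.1) fun x => ?_
  · have : {x : Fin m → ℝ | (∀ j, |x j| ≤ M) ∧ |(∑ j, c j * x j) + b| ≤ ε} =
        (⋂ j, {x | |x j| ≤ M}) ∩ {x | |(∑ j, c j * x j) + b| ≤ ε} := by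
      ext x
      simp
    rw [this]
    refine (MeasurableSet.iInter fun j => ?_).inter ?_
    · exact (isClosed_le (by fun_prop) continuous_const).measurableSet
    · exact (isClosed_le (by fun_prop) continuous_const).measurableSet
  obtain ⟨b', hb'⟩ := exists_sum_mul_update_eq c x i
  refine (measure_mono fun t ht => ?_).trans (volume_abs_mul_add_le hc (b' + b) ε)
  have := ht.2
  rw [hb'] at this
  rwa [Set.mem_ofPred_eq, ← add_assoc]

theorem volume_box_le (m : ℕ) {M : ℝ} (hM : 0 ≤ M) :
    volume {x : Fin m → ℝ | ∀ j, |x j| ≤ M} ≤ ENNReal.ofReal ((2 * M) ^ m) := by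
  have : {x : Fin m → ℝ | ∀ j, |x j| ≤ M} = Set.Icc (fun _ => -M) (fun _ => M) := by
    ext x
    simp [abs_le, Pi.le_def, forall_and]
  rw [this, Real.volume_Icc_pi, Finset.prod_const, Finset.card_univ, Fintype.card_fin,
    ← ENNReal.ofReal_pow (by linarith), show M - -M = 2 * M by ring]

/-- A slab whose coefficient vector, constant term included, has size at least `d` meets the box in
a set of measure `O(ε / d)`. -/
theorem volume_slab_le_div {m : ℕ} {c : Fin m → ℝ} {b M ε d : ℝ} (hM : 1 ≤ M) (h0 : 0 ≤ ε)
    (hd : 0 < d) (hcb : (∃ i, d ≤ |c i|) ∨ d ≤ |b|) :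
    volume {x : Fin m → ℝ | (∀ j, |x j| ≤ M) ∧ |(∑ j, c j * x j) + b| ≤ ε} ≤
      ENNReal.ofReal (4 * (m * M + 1) * (ε / d) * (2 * M) ^ m) := by
  set r : ℝ := d / (2 * (m * M + 1)) with hr
  have hK : 0 < (m : ℝ) * M + 1 := by positivity
  have hr0 : 0 < r := by positivity
  have hrd : r ≤ d := div_le_self hd.le (by nlinarith)
  by_cases hex : ∃ i, r ≤ |c i|
  · obtain ⟨i, hi⟩ := hex
    have hci : 0 < |c i| := hr0.trans_le hi
    refine (volume_slab_le (abs_pos.1 hci) b hM h0).trans (ENNReal.ofReal_le_ofReal ?_)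
    refine mul_le_mul_of_nonneg_right ?_ (by positivity)
    calc 2 * (ε / |c i|) ≤ 2 * (ε / r) := by gcongr
      _ = 4 * (m * M + 1) * (ε / d) := by rw [hr]; field_simp; ring
  · push Not at hex
    have hb : d ≤ |b| := by
      rcases hcb with ⟨i, hi⟩ | hb
      · linarith [hex i]
      · exact hb
    by_cases hεd : d ≤ 2 * ε
    · refine (measure_mono fun x hx => hx.1).trans ((volume_box_le m (by linarith)).trans
        (ENNReal.ofReal_le_ofReal (le_mul_of_one_le_left (by positivity) ?_)))
      have h1 : 1 / 2 ≤ ε / d := by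
        rw [le_div_iff₀ hd]
        linarith
      have h2 : 0 ≤ (m : ℝ) * M := by positivity
      nlinarith
    · refine le_of_eq_of_le ?_ zero_le
      convert measure_empty (μ := volume)
      refine Set.eq_empty_of_forall_notMem fun x hx => hεd ?_
      have h1 := abs_sum_mul_le hr0.le hx.1 fun j => (hex j).le
      have h2 : m * (r * M) ≤ d / 2 := by
        rw [hr, show (m : ℝ) * (d / (2 * (m * M + 1)) * M) = d / 2 * (m * M / (m * M + 1)) by
          field_simp]
        exact mul_le_of_le_one_right (by positivity) ((div_le_one hK).2 (by linarith))
      have h3 : |b| ≤ |(∑ j, c j * x j) + b| + |∑ j, c j * x j| := by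
        have := abs_sub ((∑ j, c j * x j) + b) (∑ j, c j * x j)
        rwa [add_sub_cancel_left] at this
      linarith [hx.2]

theorem volume_box_exists_int_le_div {m : ℕ} {c : Fin m → ℝ} {b M ε d : ℝ} (hM : 1 ≤ M)
    (h0 : 0 ≤ ε) (h1 : ε ≤ 1) (hd : 0 < d) (hc : ∀ i, |c i| ≤ 1)
    (hcb : ∀ p : ℤ, (∃ i, d ≤ |c i|) ∨ d ≤ |b + p|) :
    volume {x : Fin m → ℝ | (∀ j, |x j| ≤ M) ∧ ∃ p : ℤ, |(∑ j, c j * x j) + b + p| ≤ ε} ≤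
      ENNReal.ofReal ((2 * (m * M + 1) + 1) *
        (4 * (m * M + 1) * (ε / d) * (2 * M) ^ m)) := by
  refine volume_exists_int_le (B := {x : Fin m → ℝ | ∀ j, |x j| ≤ M})
    (u := fun x => (∑ j, c j * x j) + b) (b := b) (by positivity) (fun x hx => ?_) fun p => ?_
  · rw [add_sub_cancel_right]
    have := abs_sum_mul_le zero_le_one hx hc
    linarith
  · simp only [add_assoc]
    exact volume_slab_le_div hM h0 hd (hcb p)

theorem sum_snoc_mul_eq {m : ℕ} (a : Fin (m + 1) → ℝ) (x : Fin m → ℝ) (q : Fin (m + 1) → ℤ) :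
    ∑ i, (Fin.snoc x (a 0 + ∑ j : Fin m, a j.succ * x j) : Fin (m + 1) → ℝ) i * (q i : ℝ) =
      (∑ j : Fin m, ((q j.castSucc : ℝ) + a j.succ * q (Fin.last m)) * x j) +
        a 0 * q (Fin.last m) := by
  rw [Fin.sum_univ_castSucc]
  simp only [Fin.snoc_castSucc, Fin.snoc_last, add_mul, Finset.sum_add_distrib, Finset.sum_mul]
  rw [add_comm (a 0 * _), ← add_assoc]
  congr 2
  · exact Finset.sum_congr rfl fun j _ => mul_comm _ _
  · exact Finset.sum_congr rfl fun j _ => by ring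

theorem prod_mul_ite_mul_eq {m : ℕ} (P : Fin m → Prop) [DecidablePred P] (b : Fin m → ℝ) (t : ℝ) :
    (∏ j, b j * if P j then t else 1) * t =
      (∏ j, b j) * t ^ ((Finset.univ.filter P).card + 1) := by
  rw [Finset.prod_mul_distrib, Finset.prod_ite, Finset.prod_const, Finset.prod_const_one, mul_one,
    pow_succ, mul_assoc]

theorem norm_zsmul_coe_apply {n : ℕ} (a : Fin n → ℝ) (q : ℤ) (i : Fin n) :
    ‖(q • fun i => (a i : UnitAddCircle)) i‖ = |a i * q - round (a i * q)| := by
  rw [← UnitAddCircle.norm_eq, Pi.smul_apply, ← AddCircle.coe_zsmul, zsmul_eq_mul, mul_comm]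

theorem exists_norm_zsmul_le_abs_add {n : ℕ} (a : Fin n → ℝ) (q : ℤ)
    (hq : 0 < ‖q • fun i => (a i : UnitAddCircle)‖) (p : Fin n → ℤ) :
    ∃ i, ‖q • fun i => (a i : UnitAddCircle)‖ ≤ |a i * q + p i| := by
  by_contra! h
  refine lt_irrefl _ ((pi_norm_lt_iff hq).2 fun i => ?_)
  rw [norm_zsmul_coe_apply]
  refine (round_le _ (-p i)).trans_lt ?_
  rw [Int.cast_neg, sub_neg_eq_add]
  exact h i

theorem mul_pow_le_prod_max_abs {m : ℕ} (a : Fin m → ℝ) (q : Fin (m + 1) → ℤ)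
    (hq : ∀ j : Fin m, |(q j.castSucc : ℝ) + a j * q (Fin.last m)| ≤ 1 / 2) :
    (∏ j, if a j ≠ 0 then 2 / 3 * |a j| else 1) *
        |(q (Fin.last m) : ℝ)| ^ ((Finset.univ.filter fun j => a j ≠ 0).card + 1) ≤
      ∏ i, max |(q i : ℝ)| 1 := by
  rw [← prod_mul_ite_mul_eq, Fin.prod_univ_castSucc]
  refine mul_le_mul (Finset.prod_le_prod (fun j _ => by positivity) fun j _ => ?_)
    (le_max_left _ _) (abs_nonneg _) (Finset.prod_nonneg fun j _ => by positivity)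
  by_cases h : a j = 0
  · simp [h]
  · simp only [ne_eq, h, not_false_eq_true, if_true]
    rw [mul_assoc, ← abs_mul]
    have h1 := hq j
    have h2 : |a j * q (Fin.last m)| ≤
        |(q j.castSucc : ℝ) + a j * q (Fin.last m)| + |(q j.castSucc : ℝ)| := by
      have := abs_sub ((q j.castSucc : ℝ) + a j * q (Fin.last m)) (q j.castSucc : ℝ)
      rwa [add_sub_cancel_left] at this
    rcases le_total |a j * q (Fin.last m)| (3 / 2) with h3 | h3
    · exact le_max_of_le_right (by linarith)
    · exact le_max_of_le_left (by linarith)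

theorem volume_box_infinite_eq_zero {m : ℕ} {a : Fin (m + 1) → ℝ}
    (ha : ∀ v : ℝ, ((Finset.univ.filter fun i : Fin m => a i.succ ≠ 0).card : ℝ) + 1 < v →
      {q : ℤ | ∃ p : Fin (m + 1) → ℤ,
        ‖(fun i => a i * (q : ℝ) + (p i : ℝ) : Fin (m + 1) → ℝ)‖ ≤ |(q : ℝ)| ^ (-v)}.Finite)
    {M w : ℝ} (hM : 1 ≤ M) (hw : 1 < w) :
    volume {x : Fin m → ℝ | {q : Fin (m + 1) → ℤ | (∀ j, |x j| ≤ M) ∧ ∃ p : ℤ,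
      |(∑ j : Fin m, ((q j.castSucc : ℝ) + a j.succ * q (Fin.last m)) * x j) +
        a 0 * q (Fin.last m) + p| ≤ (∏ i, max |(q i : ℝ)| 1) ^ (-w)}.Infinite} = 0 := by
  set k := (Finset.univ.filter fun i : Fin m => a i.succ ≠ 0).card
  have hk1 : (0 : ℝ) < (k : ℝ) + 1 := by positivity
  set α : ℝ := ((k : ℝ) + 1) * w with hα
  have hkα : (k : ℝ) + 1 < α := lt_mul_of_one_lt_right hk1 hw
  set τ : ℝ := ((k : ℝ) + 1 + α) / 2 with hτ
  have hk0 : (0 : ℝ) ≤ k := Nat.cast_nonneg k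
  set A : Fin (m + 1) → UnitAddCircle := fun i => (a i : UnitAddCircle)
  have hfin : {q : ℤ | ‖q • A‖ ≤ |(q : ℝ)| ^ (-τ)}.Finite := by
    refine (ha τ (by linarith)).subset fun q hq => ⟨fun i => -round (a i * q), ?_⟩
    rw [Set.mem_ofPred_eq, pi_norm_le_iff_of_nonneg (by positivity)] at hq
    rw [pi_norm_le_iff_of_nonneg (by positivity)]
    intro i
    have := hq i
    rw [norm_zsmul_coe_apply] at this
    simpa [← sub_eq_add_neg] using this
  obtain ⟨c, hc, hcA⟩ := exists_pos_forall_mul_rpow_le_norm_zsmul hfin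
  have hpos : ∀ q : ℤ, q ≠ 0 → 0 < ‖q • A‖ := fun q hq => by
    have : 0 < |(q : ℝ)| := abs_pos.2 (by exact_mod_cast hq)
    exact lt_of_lt_of_le (by positivity) (hcA q hq)
  have hsum := summable_int_rpow_div_norm_zsmul (A := A) hc (by linarith : 1 ≤ τ)
    (by linarith : τ < α) (fun q => (pi_norm_le_iff_of_nonneg zero_le_one).2 fun i =>
      (AddCircle.norm_le_half_period 1 one_ne_zero).trans (by norm_num)) hcA
  set C : Set (Fin (m + 1) → ℤ) := {q | (∀ j : Fin m,
    |(q j.castSucc : ℝ) + a j.succ * q (Fin.last m)| < 1 / 2) ∧ q (Fin.last m) ≠ 0}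
  have hinj : Function.Injective fun q : C => (q : Fin (m + 1) → ℤ) (Fin.last m) := by
    rintro ⟨q, hq, hq0⟩ ⟨q', hq', hq0'⟩ h
    simp only at h
    refine Subtype.ext (funext fun i => ?_)
    refine Fin.lastCases h (fun j => ?_) i
    have h1 := hq j
    have h2 := hq' j
    rw [← h] at h2
    rw [abs_lt] at h1 h2
    have h3 : |((q j.castSucc - q' j.castSucc : ℤ) : ℝ)| < 1 := by
      push_cast
      rw [abs_lt]
      constructor <;> linarith
    have h4 : |q j.castSucc - q' j.castSucc| < 1 := by exact_mod_cast h3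
    exact sub_eq_zero.1 (Int.abs_lt_one_iff.1 h4)
  set B : ℝ := ∏ j : Fin m, if a j.succ ≠ 0 then 2 / 3 * |a j.succ| else 1
  have hB0 : 0 < B := Finset.prod_pos fun j _ => by
    split_ifs with h
    · have := abs_pos.2 h
      positivity
    · exact one_pos
  set K₁ : ℝ := (4 * M + 12) * (2 * M) ^ m with hK₁
  set K₂ : ℝ := (2 * (m * M + 1) + 1) * (4 * (m * M + 1)) * (2 * M) ^ m * B ^ (-w) with hK₂
  have hsumC : Summable (C.indicator fun q : Fin (m + 1) → ℤ =>
      K₂ * (|(q (Fin.last m) : ℝ)| ^ (-α) / ‖q (Fin.last m) • A‖)) :=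
    summable_subtype_iff_indicator.1 ((hsum.mul_left K₂).comp_injective hinj)
  have hbound := ((summable_prod_max_abs_rpow hw (m + 1)).mul_left K₁).add hsumC
  have hlim := measure_limsup_cofinite_eq_zero (μ := (volume : Measure (Fin m → ℝ)))
    (s := fun q : Fin (m + 1) → ℤ => {x : Fin m → ℝ | (∀ j, |x j| ≤ M) ∧ ∃ p : ℤ,
      |(∑ j : Fin m, ((q j.castSucc : ℝ) + a j.succ * q (Fin.last m)) * x j) +
        a 0 * q (Fin.last m) + p| ≤ (∏ i, max |(q i : ℝ)| 1) ^ (-w)})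
  rw [Filter.cofinite.limsup_set_eq] at hlim
  refine hlim (ne_top_of_le_ne_top hbound.tsum_ofReal_ne_top (ENNReal.tsum_le_tsum fun q => ?_))
  have hprod := one_le_prod_max_abs q
  have hε0 : 0 ≤ (∏ i, max |(q i : ℝ)| 1) ^ (-w) := by positivity
  have hε1 : (∏ i, max |(q i : ℝ)| 1) ^ (-w) ≤ 1 :=
    Real.rpow_le_one_of_one_le_of_nonpos hprod (by linarith)
  have hind : 0 ≤ C.indicator (fun q : Fin (m + 1) → ℤ =>
      K₂ * (|(q (Fin.last m) : ℝ)| ^ (-α) / ‖q (Fin.last m) • A‖)) q :=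
    Set.indicator_nonneg (fun q _ => by positivity) q
  by_cases hex : ∃ j : Fin m, 1 / 2 ≤ |(q j.castSucc : ℝ) + a j.succ * q (Fin.last m)|
  · obtain ⟨j, hj⟩ := hex
    refine (volume_box_exists_int_le_of_half_le
      (c := fun j => (q j.castSucc : ℝ) + a j.succ * q (Fin.last m)) hj _ hM hε0 hε1).trans
      (ENNReal.ofReal_le_ofReal ?_)
    rw [hK₁]
    linarith
  push Not at hex
  by_cases hq0 : q (Fin.last m) = 0
  · have hq : ∀ i, q i = 0 := by
      refine Fin.lastCases hq0 fun j => ?_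
      have h1 := hex j
      rw [hq0, Int.cast_zero, mul_zero, add_zero] at h1
      have h2 : |(q j.castSucc : ℝ)| < 1 := by linarith
      exact Int.abs_lt_one_iff.1 (by exact_mod_cast h2)
    refine (measure_mono fun x hx => hx.1).trans ((volume_box_le m (by linarith)).trans
      (ENNReal.ofReal_le_ofReal (le_add_of_le_of_nonneg ?_ hind)))
    simp only [hq, Int.cast_zero, abs_zero, zero_le_one, max_eq_right, Finset.prod_const_one,
      Real.one_rpow, mul_one, hK₁]
    exact le_mul_of_one_le_left (by positivity) (by linarith)
  · have hqC : q ∈ C := ⟨hex, hq0⟩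
    have hd := hpos _ hq0
    have ht : 0 < |(q (Fin.last m) : ℝ)| := abs_pos.2 (by exact_mod_cast hq0)
    refine (volume_box_exists_int_le_div
      (c := fun j => (q j.castSucc : ℝ) + a j.succ * q (Fin.last m)) hM hε0 hε1 hd
      (fun j => (hex j).le.trans (by norm_num)) fun p => ?_).trans (ENNReal.ofReal_le_ofReal ?_)
    · obtain ⟨i, hi⟩ := exists_norm_zsmul_le_abs_add a (q (Fin.last m)) hd
        (Fin.cons p fun j => q j.castSucc)
      revert hi
      refine Fin.cases (fun hi => Or.inr hi) (fun j hi => Or.inl ⟨j, ?_⟩) i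
      rwa [add_comm (q j.castSucc : ℝ)]
    · rw [Set.indicator_of_mem hqC]
      have hε : (∏ i, max |(q i : ℝ)| 1) ^ (-w) ≤ B ^ (-w) * |(q (Fin.last m) : ℝ)| ^ (-α) := by
        have h1 := mul_pow_le_prod_max_abs (fun j => a j.succ) q fun j => (hex j).le
        refine (Real.rpow_le_rpow_of_nonpos (by positivity) h1 (by linarith)).trans (le_of_eq ?_)
        rw [Real.mul_rpow hB0.le (by positivity), ← Real.rpow_natCast, ← Real.rpow_mul ht.le, hα,
          mul_neg, Nat.cast_add, Nat.cast_one]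
      refine le_add_of_nonneg_of_le (by positivity) ?_
      calc _ ≤ (2 * (m * M + 1) + 1) * (4 * (m * M + 1) *
            (B ^ (-w) * |(q (Fin.last m) : ℝ)| ^ (-α) / ‖q (Fin.last m) • A‖) * (2 * M) ^ m) := by
            gcongr
        _ = _ := by rw [hK₂]; ring

theorem isStronglyExtremal_of_finite {m : ℕ} {a : Fin (m + 1) → ℝ}
    (ha : ∀ v : ℝ, ((Finset.univ.filter fun i : Fin m => a i.succ ≠ 0).card : ℝ) + 1 < v →
      {q : ℤ | ∃ p : Fin (m + 1) → ℤ,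
        ‖(fun i => a i * (q : ℝ) + (p i : ℝ) : Fin (m + 1) → ℝ)‖ ≤ |(q : ℝ)| ^ (-v)}.Finite) :
    IsStronglyExtremal (Set.univ : Set (Fin m → ℝ))
      (fun x => Fin.snoc x (a 0 + ∑ i : Fin m, a i.succ * x i)) := by
  have hnull : volume (⋃ (M : ℕ) (N : ℕ),
      {x : Fin m → ℝ | {q : Fin (m + 1) → ℤ | (∀ j, |x j| ≤ (M : ℝ) + 1) ∧ ∃ p : ℤ,
      |(∑ j : Fin m, ((q j.castSucc : ℝ) + a j.succ * q (Fin.last m)) * x j) +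
        a 0 * q (Fin.last m) + p| ≤
          (∏ i, max |(q i : ℝ)| 1) ^ (-(1 + 1 / ((N : ℝ) + 1)))}.Infinite}) = 0 :=
    measure_iUnion_null fun M => measure_iUnion_null fun N =>
      volume_box_infinite_eq_zero ha (by linarith [(Nat.cast_nonneg M : (0 : ℝ) ≤ M)])
        (by linarith [(Nat.one_div_pos_of_nat : (0 : ℝ) < 1 / ((N : ℝ) + 1))])
  refine measure_mono_null ?_ hnull
  rintro x ⟨-, v, hv, hinf⟩
  have hn : (0 : ℝ) < ((m + 1 : ℕ) : ℝ) := by positivity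
  obtain ⟨N, hN⟩ := exists_nat_one_div_lt (sub_pos.2 ((one_lt_div hn).2 hv))
  obtain ⟨M, hM⟩ := exists_nat_ge ‖x‖
  simp only [Set.mem_iUnion]
  refine ⟨M, N, hinf.mono ?_⟩
  rintro q ⟨p, hp⟩
  rw [sum_snoc_mul_eq] at hp
  refine ⟨fun j => ?_, p, hp.trans ?_⟩
  · have := norm_le_pi_norm x j
    rw [Real.norm_eq_abs] at this
    linarith
  · exact Real.rpow_le_rpow_of_exponent_le (one_le_prod_max_abs q)
      (by linarith)

theorem isVWMA_snoc_of_infinite {m : ℕ} {a : Fin (m + 1) → ℝ} {v : ℝ}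
    (hv : ((Finset.univ.filter fun i : Fin m => a i.succ ≠ 0).card : ℝ) + 1 < v)
    (hinf : {q : ℤ | ∃ p : Fin (m + 1) → ℤ,
      ‖(fun i => a i * (q : ℝ) + (p i : ℝ) : Fin (m + 1) → ℝ)‖ ≤ |(q : ℝ)| ^ (-v)}.Infinite)
    (x : Fin m → ℝ) :
    IsVWMA (Fin.snoc x (a 0 + ∑ i : Fin m, a i.succ * x i) : Fin (m + 1) → ℝ) := by
  set k := (Finset.univ.filter fun i : Fin m => a i.succ ≠ 0).card with hk
  have hk1 : (0 : ℝ) < (k : ℝ) + 1 := by positivity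
  set w : ℝ := ((k : ℝ) + 1 + v) / (2 * (k + 1)) with hw
  have hw1 : 1 < w := (one_lt_div (by positivity)).2 (by linarith)
  have hkw : ((k : ℝ) + 1) * w < v := by
    rw [hw, show ((k : ℝ) + 1) * ((k + 1 + v) / (2 * (k + 1))) = (k + 1 + v) / 2 by field_simp]
    linarith
  have hn : (0 : ℝ) < ((m + 1 : ℕ) : ℝ) := by positivity
  refine ⟨w * (m + 1 : ℕ), lt_mul_of_one_lt_left hn hw1, ?_⟩
  rw [mul_div_cancel_right₀ _ hn.ne']
  set B : ℝ := ∏ j : Fin m, (|a j.succ| + 1) with hB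
  have hB0 : 0 < B := Finset.prod_pos fun j _ => by positivity
  set D : ℝ := (m * ‖x‖ + 1) * B ^ w with hD
  obtain ⟨T, hT⟩ := Filter.eventually_atTop.1
    ((tendsto_rpow_atTop (sub_pos.2 hkw)).eventually_ge_atTop D)
  obtain ⟨N, hN⟩ := exists_nat_ge (max T 2)
  have hlarge : ({q : ℤ | ∃ p : Fin (m + 1) → ℤ,
      ‖(fun i => a i * (q : ℝ) + (p i : ℝ) : Fin (m + 1) → ℝ)‖ ≤ |(q : ℝ)| ^ (-v)} \
      Set.Icc (-N : ℤ) N).Infinite := hinf.sdiff (Set.finite_Icc _ _)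
  choose! p hp using fun (q : ℤ) (hq : q ∈ {q : ℤ | ∃ p : Fin (m + 1) → ℤ,
    ‖(fun i => a i * (q : ℝ) + (p i : ℝ) : Fin (m + 1) → ℝ)‖ ≤ |(q : ℝ)| ^ (-v)}) => hq
  refine (hlarge.image (f := fun q : ℤ => (Fin.snoc (fun j : Fin m => p q j.succ) q :
    Fin (m + 1) → ℤ)) fun q _ q' _ h => by simpa using congrFun h (Fin.last m)).mono ?_
  rintro _ ⟨q, ⟨hq, hqN⟩, rfl⟩
  have hqN' : (N : ℝ) < |(q : ℝ)| := by
    have : (N : ℤ) < |q| := by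
      by_contra! h
      exact hqN (abs_le.1 h)
    exact_mod_cast this
  set t : ℝ := |(q : ℝ)| with ht
  have hTt : T ≤ t := (le_max_left _ _).trans (hN.trans hqN'.le)
  have h2t : 2 ≤ t := (le_max_right _ _).trans (hN.trans hqN'.le)
  have ht0 : 0 < t := by linarith
  have hε : ∀ i, |a i * q + p q i| ≤ t ^ (-v) :=
    (pi_norm_le_iff_of_nonneg (by positivity)).1 (hp q hq)
  have hε1 : t ^ (-v) < 1 := Real.rpow_lt_one_of_one_lt_of_neg (by linarith) (by linarith)
  refine ⟨p q 0, ?_⟩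
  rw [sum_snoc_mul_eq]
  simp only [Fin.snoc_castSucc, Fin.snoc_last]
  have hlhs : |(∑ j : Fin m, ((p q j.succ : ℝ) + a j.succ * q) * x j) + a 0 * q + p q 0| ≤
      (m * ‖x‖ + 1) * t ^ (-v) := by
    have h1 := abs_sum_mul_le (c := fun j : Fin m => (p q j.succ : ℝ) + a j.succ * q)
      (x := x) (M := ‖x‖) (r := t ^ (-v)) (by positivity) (fun j => norm_le_pi_norm x j)
      fun j => by rw [add_comm]; exact hε j.succ
    rw [add_assoc]
    refine (abs_add_le _ _).trans ?_
    linarith [hε 0]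
  have hprod : ∏ i, max |((Fin.snoc (fun j : Fin m => p q j.succ) q : Fin (m + 1) → ℤ) i : ℝ)| 1 ≤
      B * t ^ (k + 1) := by
    rw [hB, hk, ← prod_mul_ite_mul_eq, Fin.prod_univ_castSucc]
    simp only [Fin.snoc_castSucc, Fin.snoc_last]
    rw [max_eq_left (by linarith : 1 ≤ t)]
    refine mul_le_mul_of_nonneg_right (Finset.prod_le_prod (fun j _ => by positivity)
      fun j _ => ?_) ht0.le
    have h1 := (hε j.succ).trans_lt hε1
    by_cases h : a j.succ = 0
    · rw [h, zero_mul, zero_add] at h1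
      have h2 : p q j.succ = 0 := Int.abs_lt_one_iff.1 (by exact_mod_cast h1)
      simp [h, h2]
    · rw [if_pos h]
      have h2 := abs_sub (a j.succ * q + p q j.succ) (a j.succ * q)
      rw [add_sub_cancel_left, abs_mul] at h2
      have h3 : 0 ≤ |a j.succ| * t := by positivity
      exact max_le (by linarith) (by linarith)
  refine hlhs.trans (le_trans ?_ (Real.rpow_le_rpow_of_nonpos
    (Finset.prod_pos fun i _ => by positivity) hprod (by linarith)))
  have hDt := hT t hTt
  rw [Real.rpow_sub ht0, le_div_iff₀ (by positivity), hD] at hDt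
  rw [Real.mul_rpow hB0.le (by positivity), ← Real.rpow_natCast, ← Real.rpow_mul ht0.le, mul_neg,
    Real.rpow_neg hB0.le, Real.rpow_neg ht0.le, Real.rpow_neg ht0.le, ← mul_inv,
    ← div_eq_mul_inv, ← one_div, div_le_div_iff₀ (by positivity) (by positivity)]
  push_cast
  linarith

/-- **Corollary 5.7.** Let `L` be the affine hyperplane of `ℝ^n` (`n = m + 1 ≥ 2`)
parametrized by `x ↦ (x₁,…,x_{n-1}, a₀ + a₁x₁ + … + a_{n-1}x_{n-1})`, and let
`k = #{1 ≤ i ≤ n-1 : aᵢ ≠ 0}`. Then `L` is strongly extremal iff `a ∉ W_{k+1}^+(n,1)`,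
i.e. iff for every `v > k + 1` there are only finitely many `q ∈ ℤ` with
`‖aq + p‖ ≤ |q|^{-v}` for some `p ∈ ℤ^n`. -/
theorem hyperplane_strongly_extremal_iff (m : ℕ) (hm : 1 ≤ m) (a : Fin (m + 1) → ℝ) :
    IsStronglyExtremal (Set.univ : Set (Fin m → ℝ))
      (fun x => Fin.snoc x (a 0 + ∑ i : Fin m, a i.succ * x i)) ↔
    ∀ v : ℝ, ((Finset.univ.filter fun i : Fin m => a i.succ ≠ 0).card : ℝ) + 1 < v →
      {q : ℤ | ∃ p : Fin (m + 1) → ℤ,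
        ‖(fun i => a i * (q : ℝ) + (p i : ℝ) : Fin (m + 1) → ℝ)‖ ≤ |(q : ℝ)| ^ (-v)}.Finite := by
  refine ⟨fun h v hv => ?_, isStronglyExtremal_of_finite⟩
  by_contra hinf
  refine (isOpen_univ (X := Fin m → ℝ)).measure_ne_zero volume Set.univ_nonempty ?_
  rw [← h]
  congr 1
  ext x
  simpa using isVWMA_snoc_of_infinite hv hinf x
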